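/- Under the Section-4 setup (n ≥ 3; monotone valuations with marginal bound 1; A an EF1 allocation maximizing Σ_i v_i(A_i) among all EF1 permutations of its bundles; p*, r_i, ŵ, s_k defined as in that setup; (n,n−1,…,1) a maximum-weight simple path in G^{ŵ,id} of weight Σ_{i=2}^n(1−s_i) > n−1.5), choose e* ∈ A_1 with v_2(A_2) ≥ v_2(A_1∖{e*}), and define A' = (A_1∖{e*}, A_2, A_3, …, A_{n−1}, A_n∪{e*}) and w'_{i,j} = v_i(A'_j). Then for all i,j∈[n]: w'_{1,j} − w'_{1,1} ≤ max{0.5, v_1(A'_n) − v_1(A'_1)}; w'_{2,j} − w'_{2,2} ≤ 0.5; and w'_{i,j} − w'_{i,i} ≤ 1 for every i ≥ 3. -/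

import Mathlib

/-- `p` lies in the polyhedron `P^σ` of envy-eliminating subsidy vectors for weight matrix `w`
with respect to permutation `σ`. -/
def inP {n : ℕ} (w : Fin n → Fin n → ℝ) (σ : Equiv.Perm (Fin n)) (p : Fin n → ℝ) : Prop :=
  (∀ i, 0 ≤ p i) ∧ ∀ i j, w i j + p j ≤ w i (σ i) + p (σ i)

/-- `σ` is a maximum weight permutation for `w`. -/
def maxWeightPerm {n : ℕ} (w : Fin n → Fin n → ℝ) (σ : Equiv.Perm (Fin n)) : Prop :=
  ∀ τ : Equiv.Perm (Fin n), ∑ i, w i (τ i) ≤ ∑ i, w i (σ i)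

/-- `p` is the minimum subsidy vector for `w` with respect to `σ`:
the unique minimal element of `P^σ`. -/
def minSubsidyVec {n : ℕ} (w : Fin n → Fin n → ℝ) (σ : Equiv.Perm (Fin n))
    (p : Fin n → ℝ) : Prop :=
  inP w σ p ∧ ∀ p', inP w σ p' → ∀ i, p i ≤ p' i

/-- `A` is an ordered partition of the whole set of items. -/
def isPartition {n : ℕ} {M : Type*} [DecidableEq M] [Fintype M]
    (A : Fin n → Finset M) : Prop :=
  (∀ i j, i ≠ j → Disjoint (A i) (A j)) ∧ Finset.univ.biUnion A = Finset.univ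

/-- The allocation `A` is envy-free up to `k` items for valuations `v`. -/
def EFk {n : ℕ} {M : Type*} [DecidableEq M] (v : Fin n → Finset M → ℝ)
    (A : Fin n → Finset M) (k : ℕ) : Prop :=
  ∀ i j, ∃ X ⊆ A i ∪ A j, X.card ≤ k ∧ v i (A j \ X) ≤ v i (A i \ X)

/-- The allocation with subsidy `(A, p)` is envy-free. -/
def envyFree {n : ℕ} {M : Type*} (v : Fin n → Finset M → ℝ)
    (A : Fin n → Finset M) (p : Fin n → ℝ) : Prop :=
  ∀ i j, v i (A j) + p j ≤ v i (A i) + p i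

/-- The weight of the (simple) path visiting the vertices of the list `l` in order,
in the envy graph `G^{wh, id}` whose edge `(i, j)` has weight `wh i j - wh i i`. -/
def pathWeight {n : ℕ} (wh : Fin n → Fin n → ℝ) (l : List (Fin n)) : ℝ :=
  ((l.zip l.tail).map (fun ab => wh ab.1 ab.2 - wh ab.1 ab.1)).sum

/-- Removing at most one item lowers a valuation with marginals bounded by `1` by at most `1`. -/
lemma le_sdiff_add_one {M : Type*} [DecidableEq M] (f : Finset M → ℝ)
    (hmb : ∀ (e : M) (X : Finset M), e ∉ X → |f (insert e X) - f X| ≤ 1)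
    (Y X : Finset M) (hX : X.card ≤ 1) : f Y ≤ f (Y \ X) + 1 := by
  have insert_le : ∀ (e : M) (Z : Finset M), f (insert e Z) ≤ f Z + 1 := by
    intro e Z
    by_cases he : e ∈ Z
    · rw [Finset.insert_eq_of_mem he]; linarith
    · linarith [(abs_le.mp (hmb e Z he)).2]
  rcases Nat.le_one_iff_eq_zero_or_eq_one.mp hX with h0 | h1
  · rw [Finset.card_eq_zero.mp h0, Finset.sdiff_empty]; linarith
  · obtain ⟨e, rfl⟩ := Finset.card_eq_one.mp h1
    by_cases he : e ∈ Y
    · rw [Finset.sdiff_singleton_eq_erase]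
      simpa [Finset.insert_erase he] using insert_le e (Y.erase e)
    · rw [Finset.sdiff_singleton_eq_erase, Finset.erase_eq_of_notMem he]; linarith

/-- In an `EF1` allocation nobody envies by more than `1`. -/
lemma EFk.le_add_one {n : ℕ} {M : Type*} [DecidableEq M] {v : Fin n → Finset M → ℝ}
    (hmono : ∀ (i : Fin n) (X Y : Finset M), X ⊆ Y → v i X ≤ v i Y)
    (hmb : ∀ (i : Fin n) (e : M) (X : Finset M), e ∉ X → |v i (insert e X) - v i X| ≤ 1)
    {A : Fin n → Finset M} (h : EFk v A 1) (i j : Fin n) :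
    v i (A j) ≤ v i (A i) + 1 := by
  obtain ⟨X, -, hc, hX⟩ := h i j
  linarith [le_sdiff_add_one (v i) (hmb i) (A j) X hc,
    hmono i _ _ (Finset.sdiff_subset (s := A i) (t := X))]

/-- In an `EF1` allocation, an agent who receives a bundle she values at least as much as her own
is still envy-free up to one item towards every other bundle. -/
lemma EFk.exists_of_le {n : ℕ} {M : Type*} [DecidableEq M] {v : Fin n → Finset M → ℝ}
    (hmono : ∀ (i : Fin n) (X Y : Finset M), X ⊆ Y → v i X ≤ v i Y)
    {A : Fin n → Finset M} (hdisj : ∀ i j, i ≠ j → Disjoint (A i) (A j)) (h : EFk v A 1)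
    {i k : Fin n} (hk : v i (A i) ≤ v i (A k)) (j : Fin n) :
    ∃ X ⊆ A k ∪ A j, X.card ≤ 1 ∧ v i (A j \ X) ≤ v i (A k \ X) := by
  by_cases hkj : k = j
  · subst hkj
    exact ⟨∅, by simp, by simp, le_rfl⟩
  obtain ⟨X, -, hc, hX⟩ := h i j
  refine ⟨A j ∩ X, Finset.inter_subset_left.trans Finset.subset_union_right,
    (Finset.card_le_card Finset.inter_subset_right).trans hc, ?_⟩
  rw [Finset.sdiff_inter_self_left,
    Finset.sdiff_eq_self_of_disjoint ((hdisj k j hkj).mono_right Finset.inter_subset_left)]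
  linarith [hmono i _ _ (Finset.sdiff_subset (s := A i) (t := X))]

theorem modified_allocation_edge_weights {n : ℕ} (hn : 3 ≤ n)
    {M : Type*} [DecidableEq M] [Fintype M]
    (v : Fin n → Finset M → ℝ)
    (hmono : ∀ (i : Fin n) (X Y : Finset M), X ⊆ Y → v i X ≤ v i Y)
    (hmb : ∀ (i : Fin n) (e : M) (X : Finset M), e ∉ X → |v i (insert e X) - v i X| ≤ 1)
    (A : Fin n → Finset M) (hpart : isPartition A)
    (hEF1 : EFk v A 1)
    (hopt : ∀ σ : Equiv.Perm (Fin n),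
      EFk v (fun i => A (σ i)) 1 → ∑ i, v i (A (σ i)) ≤ ∑ i, v i (A i))
    (w : Fin n → Fin n → ℝ) (hw : ∀ i j, w i j = v i (A j))
    (σ : Equiv.Perm (Fin n)) (hσ : maxWeightPerm w σ)
    (p : Fin n → ℝ) (hp : minSubsidyVec w σ p)
    (q : Fin n → ℝ) (hq : ∀ i, IsGreatest (Set.range fun j => w i j + p j) (q i))
    (r : Fin n → ℝ) (hr : ∀ i, r i = q i - (w i i + p i))
    (wh : Fin n → Fin n → ℝ)
    (hwh : ∀ i j, wh i j = if i = j then v i (A i) + r i else v i (A j))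
    (s : Fin n → ℝ)
    (hs : ∀ k : Fin n, k ≠ ⟨0, by omega⟩ →
      s k = 1 + r k + v k (A k)
        - v k (A ⟨(k : ℕ) - 1, Nat.lt_of_le_of_lt (Nat.sub_le _ _) k.isLt⟩))
    (hpathmax : ∀ l : List (Fin n), l.Nodup →
      pathWeight wh l ≤ pathWeight wh (List.finRange n).reverse)
    (hweight : (n : ℝ) - 1.5 <
      ∑ k ∈ Finset.univ.filter (fun k : Fin n => k ≠ ⟨0, by omega⟩), (1 - s k))
    -- the item `e*` removed from agent 1's bundle
    (estar : M) (hestar : estar ∈ A ⟨0, by omega⟩)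
    (hestar2 : v ⟨1, by omega⟩ ((A ⟨0, by omega⟩).erase estar) ≤ v ⟨1, by omega⟩ (A ⟨1, by omega⟩))
    -- the modified allocation `A' = (A_1 \ {e*}, A_2, ..., A_{n-1}, A_n ∪ {e*})`
    (A' : Fin n → Finset M)
    (hA' : ∀ i : Fin n, A' i =
      if i = ⟨0, by omega⟩ then (A ⟨0, by omega⟩).erase estar
      else if i = ⟨n - 1, by omega⟩ then insert estar (A ⟨n - 1, by omega⟩)
      else A i)
    (w' : Fin n → Fin n → ℝ) (hw' : ∀ i j, w' i j = v i (A' j)) :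
    (∀ j : Fin n, w' ⟨0, by omega⟩ j - w' ⟨0, by omega⟩ ⟨0, by omega⟩ ≤
      max 0.5 (v ⟨0, by omega⟩ (A' ⟨n - 1, by omega⟩) - v ⟨0, by omega⟩ (A' ⟨0, by omega⟩))) ∧
    (∀ j : Fin n, w' ⟨1, by omega⟩ j - w' ⟨1, by omega⟩ ⟨1, by omega⟩ ≤ 0.5) ∧
    (∀ i j : Fin n, 2 ≤ (i : ℕ) → w' i j - w' i i ≤ 1) := by
  obtain ⟨hdisj, -⟩ := hpart
  have hgap := EFk.le_add_one hmono hmb hEF1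
  have hr0 : ∀ i, 0 ≤ r i := fun i => by
    have := (hq i).2 ⟨i, rfl⟩
    simp only at this
    linarith [hr i]
  have hfeas : ∀ i j, v i (A j) + p j ≤ v i (A i) + r i + p i := fun i j => by
    have := (hq i).2 ⟨j, rfl⟩
    simp only [hw] at this
    linarith [hr i, hw i i]
  have hrs : ∀ k : Fin n, k ≠ ⟨0, by omega⟩ → r k ≤ s k := fun k hk => by
    linarith [hs k hk, hgap k ⟨(k : ℕ) - 1, Nat.lt_of_le_of_lt (Nat.sub_le _ _) k.isLt⟩]
  have hsum : ∑ k ∈ Finset.univ.filter (fun k : Fin n => k ≠ ⟨0, by omega⟩), s k < 1 / 2 := by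
    have hcard : (Finset.univ.filter (fun k : Fin n => k ≠ ⟨0, by omega⟩)).card = n - 1 := by
      rw [Finset.filter_ne', Finset.card_erase_of_mem (Finset.mem_univ _), Finset.card_univ,
        Fintype.card_fin]
    rw [Finset.sum_sub_distrib, Finset.sum_const, hcard, nsmul_eq_mul,
      Nat.cast_sub (by omega)] at hweight
    norm_num at hweight ⊢
    linarith
  have hpair : ∀ i j : Fin n, i ≠ ⟨0, by omega⟩ → j ≠ ⟨0, by omega⟩ → i ≠ j →
      s i + s j < 1 / 2 := fun i j hi hj hij => by
    rw [← Finset.sum_pair hij]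
    refine lt_of_le_of_lt (Finset.sum_le_sum_of_subset_of_nonneg ?_ ?_) hsum
    · intro k hk
      simp only [Finset.mem_insert, Finset.mem_singleton] at hk
      rcases hk with rfl | rfl <;> simpa
    · intro k hk _
      have hk0 := (Finset.mem_filter.mp hk).2
      exact (hr0 k).trans (hrs k hk0)
  have hsingle : ∀ i : Fin n, i ≠ ⟨0, by omega⟩ → s i < 1 / 2 := fun i hi => by
    refine lt_of_le_of_lt (Finset.single_le_sum (f := s) ?_ ?_) hsum
    · intro k hk
      have hk0 := (Finset.mem_filter.mp hk).2
      exact (hr0 k).trans (hrs k hk0)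
    · simpa using hi
  have hstep : ∀ k : Fin n, k ≠ ⟨0, by omega⟩ →
      p ⟨(k : ℕ) - 1, Nat.lt_of_le_of_lt (Nat.sub_le _ _) k.isLt⟩ + (1 - s k) ≤ p k :=
    fun k hk => by
      linarith [hs k hk, hfeas k ⟨(k : ℕ) - 1, Nat.lt_of_le_of_lt (Nat.sub_le _ _) k.isLt⟩]
  have hpmono : ∀ (d : ℕ) (i j : Fin n), (j : ℕ) = i + d → p i ≤ p j := by
    intro d
    induction d with
    | zero => intro i j h; rw [Fin.ext h]
    | succ d ih =>
      intro i j h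
      have hj : j ≠ ⟨0, by omega⟩ := fun h0 => by rw [h0] at h; simp at h
      have h1 := ih i ⟨(j : ℕ) - 1, Nat.lt_of_le_of_lt (Nat.sub_le _ _) j.isLt⟩
        (by simp only; omega)
      have h2 := hsingle j hj
      linarith [hstep j hj]
  have hfar : ∀ i j : Fin n, i ≠ ⟨0, by omega⟩ → i < j → v i (A j) ≤ v i (A i) - 1 / 2 := by
    intro i j hi hij
    have hij' : (i : ℕ) < j := hij
    have hj : j ≠ ⟨0, by omega⟩ := fun h0 => by rw [h0] at hij'; simp at hij'
    have h1 := hpmono ((j : ℕ) - 1 - i) i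
      ⟨(j : ℕ) - 1, Nat.lt_of_le_of_lt (Nat.sub_le _ _) j.isLt⟩ (by simp only; omega)
    have h2 := hpair i j hi hj hij.ne
    linarith [hstep j hj, hfeas i j, hrs i hi]
  have hlast : ∀ i, v i (insert estar (A ⟨n - 1, by omega⟩)) ≤ v i (A ⟨n - 1, by omega⟩) + 1 := by
    intro i
    have hnot : estar ∉ A ⟨n - 1, by omega⟩ :=
      Finset.disjoint_left.mp (hdisj _ _ (by simp [Fin.ext_iff]; omega)) hestar
    linarith [(abs_le.mp (hmb i estar _ hnot)).2]
  have herase : ∀ i, v i ((A ⟨0, by omega⟩).erase estar) ≤ v i (A ⟨0, by omega⟩) := fun i =>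
    hmono i _ _ (Finset.erase_subset _ _)
  have herase' : ∀ i, v i (A ⟨0, by omega⟩) ≤ v i ((A ⟨0, by omega⟩).erase estar) + 1 := fun i => by
    simpa [Finset.sdiff_singleton_eq_erase] using
      le_sdiff_add_one (v i) (hmb i) (A ⟨0, by omega⟩) {estar} (by simp)
  have hA'0 : A' ⟨0, by omega⟩ = (A ⟨0, by omega⟩).erase estar := by rw [hA', if_pos rfl]
  have hA'last : A' ⟨n - 1, by omega⟩ = insert estar (A ⟨n - 1, by omega⟩) := by
    rw [hA', if_neg (by simp [Fin.ext_iff]; omega), if_pos rfl]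
  have hA'mid : ∀ j : Fin n, j ≠ ⟨0, by omega⟩ → j ≠ ⟨n - 1, by omega⟩ → A' j = A j :=
    fun j h0 h1 => by rw [hA', if_neg h0, if_neg h1]
  have hprev : ∀ k : Fin n, k ≠ ⟨0, by omega⟩ →
      v k (A k) + 1 / 2 ≤ v k (A ⟨(k : ℕ) - 1, Nat.lt_of_le_of_lt (Nat.sub_le _ _) k.isLt⟩) :=
    fun k hk => by
      have := hsingle k hk
      linarith [hs k hk, hr0 k]
  have hbest : ∀ j : Fin n, j ≠ ⟨0, by omega⟩ →
      v ⟨0, by omega⟩ (A j) - v ⟨0, by omega⟩ ((A ⟨0, by omega⟩).erase estar) ≤ 1 / 2 := by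
    obtain ⟨m, hm, hmax⟩ := Finset.exists_max_image
      (Finset.univ.filter (fun k : Fin n => k ≠ ⟨0, by omega⟩)) (fun k => v ⟨0, by omega⟩ (A k))
      ⟨⟨1, by omega⟩, by simp⟩
    have hm0 : m ≠ ⟨0, by omega⟩ := (Finset.mem_filter.mp hm).2
    intro j hj
    refine le_trans (sub_le_sub_right (hmax j (by simpa using hj)) _) ?_
    by_contra! hcon
    have : NeZero n := ⟨by omega⟩
    set τ : Equiv.Perm (Fin n) := (Fin.cycleRange m).symm with hτ
    have hτ0 : τ ⟨0, by omega⟩ = m := by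
      rw [hτ, Equiv.symm_apply_eq, Fin.cycleRange_self]; rfl
    have hτle : ∀ k : Fin n, k ≠ ⟨0, by omega⟩ → k ≤ m →
        τ k = ⟨(k : ℕ) - 1, Nat.lt_of_le_of_lt (Nat.sub_le _ _) k.isLt⟩ := by
      intro k hk hkm
      have hk0 : (k : ℕ) ≠ 0 := fun h => hk (Fin.ext h)
      have hkm' : (k : ℕ) ≤ m := hkm
      rw [hτ, Equiv.symm_apply_eq]
      ext
      rw [Fin.coe_cycleRange_of_lt (Fin.lt_def.mpr (by simp only; omega))]
      simp only
      omega
    have hτgt : ∀ k : Fin n, m < k → τ k = k := by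
      intro k hk
      rw [hτ, Equiv.symm_apply_eq, Fin.cycleRange_of_gt hk]
    have hge : ∀ k : Fin n, k ≠ ⟨0, by omega⟩ → v k (A k) ≤ v k (A (τ k)) := by
      intro k hk
      rcases le_or_gt k m with hkm | hkm
      · rw [hτle k hk hkm]
        have := hprev k hk
        linarith
      · rw [hτgt k hkm]
    have hEFτ : EFk v (fun i => A (τ i)) 1 := by
      intro i j
      by_cases hi : i = ⟨0, by omega⟩
      · subst hi
        simp only [hτ0]
        by_cases hj0 : τ j = ⟨0, by omega⟩
        · rw [hj0]
          have hnot : estar ∉ A m := Finset.disjoint_left.mp (hdisj _ _ hm0.symm) hestar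
          refine ⟨{estar}, Finset.singleton_subset_iff.mpr (Finset.mem_union_right _ hestar), by simp, ?_⟩
          rw [Finset.sdiff_singleton_eq_erase, Finset.sdiff_singleton_eq_erase,
            Finset.erase_eq_of_notMem hnot]
          linarith
        · exact ⟨∅, by simp, by simp, by
            simpa using hmax (τ j) (Finset.mem_filter.mpr ⟨Finset.mem_univ _, hj0⟩)⟩
      · exact EFk.exists_of_le hmono hdisj hEF1 (hge i hi) (τ j)
    have hopt' := sub_nonpos.mpr (hopt τ hEFτ)
    rw [← Finset.sum_sub_distrib] at hopt'
    have htwo : ∑ i ∈ {⟨0, by omega⟩, m}, (v i (A (τ i)) - v i (A i)) ≤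
        ∑ i, (v i (A (τ i)) - v i (A i)) := by
      refine Finset.sum_le_sum_of_subset_of_nonneg (Finset.subset_univ _) fun k _ hk => ?_
      have hk0 : k ≠ ⟨0, by omega⟩ := fun h => hk (by simp [h])
      linarith [hge k hk0]
    rw [Finset.sum_pair hm0.symm, hτ0, hτle m hm0 le_rfl] at htwo
    have := hprev m hm0
    have := herase' ⟨0, by omega⟩
    linarith
  rw [show (0.5 : ℝ) = 1 / 2 by norm_num]
  refine ⟨fun j => ?_, fun j => ?_, fun i j hi => ?_⟩
  · rw [hw', hw']
    by_cases hj0 : j = ⟨0, by omega⟩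
    · subst hj0
      exact le_max_of_le_left (by norm_num)
    by_cases hj1 : j = ⟨n - 1, by omega⟩
    · subst hj1
      exact le_max_right _ _
    rw [hA'mid j hj0 hj1]
    refine le_max_of_le_left ?_
    rw [hA'0]
    exact hbest j hj0
  · have h1 : (⟨1, by omega⟩ : Fin n) ≠ ⟨0, by omega⟩ := by simp
    rw [hw', hw', hA'mid ⟨1, by omega⟩ h1 (by simp [Fin.ext_iff]; omega)]
    by_cases hj0 : j = ⟨0, by omega⟩
    · subst hj0
      rw [hA'0]
      norm_num
      linarith
    by_cases hj1 : j = ⟨n - 1, by omega⟩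
    · subst hj1
      rw [hA'last]
      have := hfar ⟨1, by omega⟩ ⟨n - 1, by omega⟩ h1 (Fin.lt_def.mpr (by simp only; omega))
      have := hlast ⟨1, by omega⟩
      linarith
    rw [hA'mid j hj0 hj1]
    by_cases hj2 : j = ⟨1, by omega⟩
    · subst hj2
      norm_num
    have := hfar ⟨1, by omega⟩ j h1 (Fin.lt_def.mpr (by
      have h2 : (j : ℕ) ≠ 0 := fun h => hj0 (Fin.ext h)
      have h3 : (j : ℕ) ≠ 1 := fun h => hj2 (Fin.ext h)
      simp only
      omega))
    linarith
  · have hi0 : i ≠ ⟨0, by omega⟩ := fun h => by rw [h] at hi; simp at hi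
    rw [hw', hw']
    have hown : v i (A i) ≤ v i (A' i) := by
      by_cases hi1 : i = ⟨n - 1, by omega⟩
      · rw [hi1, hA'last]
        exact hmono _ _ _ (Finset.subset_insert _ _)
      · rw [hA'mid i hi0 hi1]
    by_cases hij : i = j
    · subst hij
      norm_num
    by_cases hj0 : j = ⟨0, by omega⟩
    · subst hj0
      rw [hA'0]
      linarith [herase i, hgap i ⟨0, by omega⟩]
    by_cases hj1 : j = ⟨n - 1, by omega⟩
    · subst hj1
      rw [hA'last]
      have := hfar i ⟨n - 1, by omega⟩ hi0 (Fin.lt_def.mpr (by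
        have h1 : (i : ℕ) ≠ n - 1 := fun h => hij (Fin.ext h)
        simp only
        omega))
      have := hlast i
      linarith
    rw [hA'mid j hj0 hj1]
    linarith [hgap i j]
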